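/- Let a group G act freely on a tree T, let γ ∈ G be a hyperbolic element, and let H ≤ G be a subgroup acting with finitely many orbits of vertices on its minimal invariant subtree T_H. If Axis(γ) ∩ T_H contains infinitely many vertices, then γ^n ∈ H for some nonzero integer n. -/

import Mathlib

/-- In a tree, gluing paths leaving a set at both ends of a walk inside the set gives a geodesic. -/
theorem tree_concat_le_dist {V : Type*} {T : SimpleGraph V} (hT : T.IsTree) (P : Set V)
    {v p q w : V} (w1 : T.Walk v p) (w2 : T.Walk p q) (w3 : T.Walk q w)
    (h1 : w1.IsPath) (h3 : w3.IsPath) (hpq : p ≠ q)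
    (e1 : ∀ e ∈ w1.edges, ¬ ∀ x ∈ e, x ∈ P)
    (e2 : ∀ e ∈ w2.edges, ∀ x ∈ e, x ∈ P)
    (e3 : ∀ e ∈ w3.edges, ¬ ∀ x ∈ e, x ∈ P) :
    w1.length + T.dist p q + w3.length ≤ T.dist v w := by
  classical
  have e2' : ∀ e ∈ w2.bypass.edges, ∀ x ∈ e, x ∈ P := fun e he =>
    e2 e (w2.edges_bypass_subset_edges he)
  have hb := w2.bypass_isPath
  generalize w2.bypass = b at e2' hb
  have hbne : b.edges ≠ [] := by
    intro h
    cases b with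
    | nil => exact hpq rfl
    | cons _ _ => simp at h
  have hpath : (w1.append (b.append w3)).IsPath := by
    rw [hT.isAcyclic.isPath_iff_isChain]
    rw [hT.isAcyclic.isPath_iff_isChain] at h1 h3 hb
    simp only [SimpleGraph.Walk.edges_append]
    rw [List.isChain_append, List.isChain_append]
    refine ⟨h1, ⟨hb, h3, ?_⟩, ?_⟩
    · intro x hx y hy hxy
      subst hxy
      exact e3 x (List.mem_of_mem_head? hy) (e2' x (List.mem_of_mem_getLast? hx))
    · intro x hx y hy hxy
      subst hxy
      rw [List.head?_append_of_ne_nil _ hbne] at hy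
      exact e1 x (List.mem_of_mem_getLast? hx) (e2' x (List.mem_of_mem_head? hy))
  obtain ⟨g, hg, hgl⟩ := hT.connected.exists_path_of_dist v w
  have := congrArg (fun r : T.Path v w => r.1.length)
    (hT.isAcyclic.path_unique ⟨_, hpath⟩ ⟨g, hg⟩)
  simp only [SimpleGraph.Walk.length_append] at this
  have := SimpleGraph.dist_le b
  omega

/-- An action preserving adjacency preserves distances. -/
theorem dist_smul_of_act {V : Type*} {T : SimpleGraph V} (hT : T.Connected)
    {G : Type*} [Group G] [MulAction G V]
    (hact : ∀ (g : G) (u v : V), T.Adj u v → T.Adj (g • u) (g • v)) (g : G) (u v : V) :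
    T.dist (g • u) (g • v) = T.dist u v := by
  have key : ∀ (g : G) (u v : V), T.dist (g • u) (g • v) ≤ T.dist u v := by
    intro g u v
    obtain ⟨w, hw⟩ := hT.exists_walk_length_eq_dist u v
    let f : T →g T := ⟨fun x => g • x, fun h => hact g _ _ h⟩
    rw [← hw, ← SimpleGraph.Walk.length_map f w]
    exact SimpleGraph.dist_le (w.map f)
  apply le_antisymm (key g u v)
  simpa using key g⁻¹ (g • u) (g • v)

/-- A vertex minimally displaced by `γ` that is closest to `x` within the invariant subtree
spanned by a walk `a → γ a` is equal to `x`. -/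
theorem eq_of_closest {V : Type*} {T : SimpleGraph V} (hT : T.IsTree)
    {G : Type*} [Group G] [MulAction G V]
    (hact : ∀ (g : G) (u v : V), T.Adj u v → T.Adj (g • u) (g • v))
    (γ : G) (L : ℕ) (hL : 0 < L) (hmin : ∀ v : V, L ≤ T.dist v (γ • v))
    (a : V) (W : T.Walk a (γ • a)) (x v : V) (hx : x ∈ W.support)
    (hv : T.dist v (γ • v) = L)
    (hcl : ∀ y ∈ W.support, ∀ k : ℤ, T.dist v x ≤ T.dist v (γ ^ k • y)) : v = x := by
  classical
  let P : Set V := {z | ∃ y ∈ W.support, ∃ k : ℤ, γ ^ k • y = z}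
  have hclP : ∀ z ∈ P, T.dist v x ≤ T.dist v z := by
    rintro z ⟨y, hy, k, rfl⟩
    exact hcl y hy k
  have hPW : ∀ y ∈ W.support, y ∈ P := fun y hy => ⟨y, hy, 0, by simp⟩
  have hPs : ∀ z, z ∈ P → γ • z ∈ P := by
    rintro z ⟨y, hy, k, rfl⟩
    exact ⟨y, hy, 1 + k, by rw [zpow_add, mul_smul, zpow_one]⟩
  have hPi : ∀ z, γ • z ∈ P → z ∈ P := by
    rintro z ⟨y, hy, k, h⟩
    refine ⟨y, hy, -1 + k, ?_⟩
    rw [zpow_add, mul_smul, h, zpow_neg_one, inv_smul_smul]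
  let f : T →g T := ⟨fun x => γ • x, fun h => hact γ _ _ h⟩
  have hfi : Function.Injective f := fun u v h => MulAction.injective γ h
  obtain ⟨w1, h1, hl⟩ := hT.connected.exists_path_of_dist v x
  have hs : ∀ z ∈ w1.support, z ∈ P → z = x := by
    intro z hz hzP
    by_contra hne
    have := SimpleGraph.Walk.length_takeUntil_lt_length hz hne
    have := SimpleGraph.dist_le (w1.takeUntil z hz)
    have := hclP z hzP
    omega
  have e1 : ∀ e ∈ w1.edges, ¬ ∀ x ∈ e, x ∈ P := by
    intro e he h
    induction e with
    | _ s t =>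
      have hst := (w1.adj_of_mem_edges he).ne
      apply hst
      rw [hs s (w1.fst_mem_support_of_mem_edges he) (h s (by simp)),
        hs t (w1.snd_mem_support_of_mem_edges he) (h t (by simp))]
  have hx' : f x ∈ (W.map f).support := by
    rw [SimpleGraph.Walk.support_map]
    exact List.mem_map_of_mem hx
  let w2 : T.Walk x (f x) := (W.dropUntil x hx).append ((W.map f).takeUntil (f x) hx')
  let w3 : T.Walk (f x) (f v) := (w1.map f).reverse
  have key := tree_concat_le_dist hT P w1 w2 w3 h1
    ((SimpleGraph.Walk.map_isPath_of_injective hfi h1).reverse)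
    (by
      intro h
      have h2 := hmin x
      have h3 : γ • x = x := h.symm
      rw [h3, SimpleGraph.dist_self] at h2
      omega) e1
    (by
      intro e he
      simp only [w2, SimpleGraph.Walk.edges_append, List.mem_append] at he
      rcases he with he | he
      · have he := W.edges_dropUntil_subset_edges hx he
        intro z hz
        exact hPW z (SimpleGraph.Walk.mem_support_of_mem_edges he hz)
      · have he := (W.map f).edges_takeUntil_subset_edges hx' he
        intro z hz
        have := SimpleGraph.Walk.mem_support_of_mem_edges he hz
        rw [SimpleGraph.Walk.support_map, List.mem_map] at this
        obtain ⟨y, hy, rfl⟩ := this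
        exact hPs y (hPW y hy))
    (by
      intro e he h
      simp only [w3, SimpleGraph.Walk.edges_reverse, List.mem_reverse,
        SimpleGraph.Walk.edges_map, List.mem_map] at he
      obtain ⟨e, he, rfl⟩ := he
      apply e1 e he
      intro z hz
      exact hPi z (h (f z) (Sym2.mem_map.mpr ⟨z, hz, rfl⟩)))
  have h3 : w3.length = w1.length := by simp [w3]
  have h4 : T.dist (v) (f v) = L := hv
  have h5 : L ≤ T.dist x (f x) := hmin x
  apply hT.connected.dist_eq_zero_iff.mp
  omega

/-- Let a group `G` act freely on a tree `T`, preserving adjacency.  Let `γ ∈ G` be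
hyperbolic with translation length `L > 0` and axis `A` (the vertices displaced
exactly `L`, where `L` is the minimal displacement).  Let `H ≤ G`, and let `S` be an
`H`-invariant subtree (a connected set of vertices) on which `H` acts with finitely
many vertex orbits.  If `Axis(γ) ∩ S` contains infinitely many vertices, then
`γ^n ∈ H` for some nonzero integer `n`. -/
theorem power_in_subgroup_of_axis_meets_core {V : Type*} (T : SimpleGraph V)
    (hT : T.IsTree) {G : Type*} [Group G] [MulAction G V]
    (hact : ∀ (g : G) (u v : V), T.Adj u v → T.Adj (g • u) (g • v))
    (hfree : ∀ g : G, g ≠ 1 → ∀ v : V, g • v ≠ v)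
    (γ : G) (L : ℕ) (hL : 0 < L)
    (hmin : ∀ v : V, L ≤ T.dist v (γ • v))
    (A : Set V) (hA : ∀ v : V, v ∈ A ↔ T.dist v (γ • v) = L)
    (H : Subgroup G) (S : Set V)
    (hSconn : (SimpleGraph.induce S T).Connected)
    (hSinv : ∀ h ∈ H, ∀ v ∈ S, h • v ∈ S)
    (F : Finset V) (hF : ∀ v ∈ S, ∃ h ∈ H, ∃ f ∈ F, h • f = v)
    (hinf : (A ∩ S).Infinite) :
    ∃ n : ℤ, n ≠ 0 ∧ γ ^ n ∈ H := by
  classical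
  obtain ⟨a, haA, -⟩ := hinf.nonempty
  obtain ⟨W⟩ := hT.connected a (γ • a)
  have hdist := dist_smul_of_act hT.connected hact
  -- every vertex of the axis is a translate of a vertex of `W`
  have hcov : ∀ v ∈ A, ∃ y ∈ W.support, ∃ k : ℤ, γ ^ k • y = v := by
    intro v hv
    have hne : ∃ n : ℕ, ∃ y ∈ W.support, ∃ k : ℤ, T.dist v (γ ^ k • y) = n :=
      ⟨_, a, W.start_mem_support, 0, rfl⟩
    obtain ⟨x, hx, k, hk⟩ := Nat.find_spec hne
    have hm : ∀ y ∈ W.support, ∀ j : ℤ, Nat.find hne ≤ T.dist v (γ ^ j • y) :=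
      fun y hy j => Nat.find_min' hne ⟨y, hy, j, rfl⟩
    have hback : ∀ z, T.dist (γ ^ (-k) • v) z = T.dist v (γ ^ k • z) := by
      intro z
      rw [← hdist (γ ^ k) (γ ^ (-k) • v) z, smul_smul, ← zpow_add]
      simp
    have := eq_of_closest hT hact γ L hL hmin a W x (γ ^ (-k) • v) hx (by
      rw [smul_smul, ← zpow_one_add, add_comm, zpow_add_one, mul_smul, hdist]
      exact (hA v).mp hv) (by
      intro y hy j
      rw [hback, hback, hk, smul_smul, ← zpow_add]
      exact hm y hy _)
    refine ⟨x, hx, k, ?_⟩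
    rw [← this, smul_smul, ← zpow_add]
    simp
  choose! y hy k hk using hcov
  choose! h hh f hf hhf using hF
  obtain ⟨v, hv, w, hw, hvw, heq⟩ := hinf.exists_ne_map_eq_of_mapsTo
    (f := fun v => (y v, f v)) (t := ((W.support.toFinset ×ˢ F : Finset (V × V)) : Set (V × V)))
    (by
      intro v hv
      simp only [Finset.coe_product, Set.mem_prod, Finset.mem_coe, List.mem_toFinset]
      exact ⟨hy v hv.1, hf v hv.2⟩) (Finset.finite_toSet _)
  simp only [Prod.mk.injEq] at heq
  obtain ⟨hyy, hff⟩ := heq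
  refine ⟨k w - k v, ?_, ?_⟩
  · intro h0
    apply hvw
    rw [← hk v hv.1, ← hk w hw.1, hyy, sub_eq_zero.mp h0]
  · have h1 : h w * (h v)⁻¹ ∈ H := H.mul_mem (hh w hw.2) (H.inv_mem (hh v hv.2))
    have h2 : (γ ^ (k w - k v)) • v = w := by
      conv_lhs => arg 2; rw [← hk v hv.1]
      rw [smul_smul, ← zpow_add, sub_add_cancel, hyy, hk w hw.1]
    have h3 : (h w * (h v)⁻¹) • v = w := by
      conv_lhs => arg 2; rw [← hhf v hv.2]
      rw [mul_smul, inv_smul_smul, hff, hhf w hw.2]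
    have h4 : (h w * (h v)⁻¹)⁻¹ * γ ^ (k w - k v) = 1 := by
      by_contra hne
      apply hfree _ hne v
      rw [mul_smul, h2, inv_smul_eq_iff, h3]
    rw [← inv_mul_eq_one.mp h4]
    exact h1
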